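/- arXiv:1305.3207 — 2 statements merged into one kernel-verified Lean document; each statement's English description precedes it below -/
import Mathlib

section
/- There exist universal constants C, c > 0 such that for all integers k, t, N ≥ 1, all ε ∈ (0,1) and all τ ≥ 0, there is a sample size m ≤ C·k·t·(log(kt/ε))^c / ε² and a learning algorithm A using m samples over the 2N-point discrete domain D = {−N/N, −(N−1)/N, …, −1/N, 0, 1/N, …, (N−1)/N} such that: for every probability distribution p over D that is a k-mixture of (τ,t)-flat discrete distributions, with probability at least 9/10 over m i.i.d. samples s drawn from p, A(s) is a distribution over D with d_TV(p, A(s)) ≤ C·(ε + τ). (Theorem thm:opt-discrete.) -/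
open MeasureTheory
open scoped ENNReal

/-- q is t-flat on the ordered 2N-point domain (encoded as Fin n): there is a
partition into t intervals on each of which q is constant. -/
def IsFlat (n t : ℕ) (q : Fin n → ℝ) : Prop :=
  ∃ (b : Fin (t + 1) → ℕ) (c : Fin t → ℝ), Monotone b ∧ b 0 = 0 ∧ b (Fin.last t) = n ∧
    ∀ (i : Fin t) (x : Fin n), b i.castSucc ≤ (x : ℕ) → (x : ℕ) < b i.succ → q x = c i

/-- The measure on the discrete domain with point masses given by p. -/
noncomputable def discMeasure {n : ℕ} (p : Fin n → ℝ) : Measure (Fin n) :=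
  ∑ x, ENNReal.ofReal (p x) • Measure.dirac x

/-- One-sided Hoeffding bound for the empirical mean of a `[0, 1]`-valued function. -/
theorem hoeffding_unit_upper {α : Type*} [MeasurableSpace α] (ν : Measure α)
    [IsProbabilityMeasure ν] (m : ℕ) (f : α → ℝ) (hf : Measurable f)
    (h01 : ∀ x, f x ∈ Set.Icc (0 : ℝ) 1) {δ : ℝ} (hδ : 0 ≤ δ) :
    (Measure.pi fun _ : Fin m => ν).real {s | δ * m ≤ ∑ i, (f (s i) - ∫ x, f x ∂ν)} ≤
      Real.exp (-(2 * m * δ ^ 2)) := by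
  have hindep : ProbabilityTheory.iIndepFun
      (fun (i : Fin m) (s : Fin m → α) => f (s i) - ∫ x, f x ∂ν)
      (Measure.pi fun _ : Fin m => ν) :=
    ProbabilityTheory.iIndepFun_pi (X := fun _ x => f x - ∫ x, f x ∂ν)
      fun _ => (hf.sub_const _).aemeasurable
  have hsub (i : Fin m) : ProbabilityTheory.HasSubgaussianMGF
      (fun s : Fin m → α => f (s i) - ∫ x, f x ∂ν) (1 / 4) (Measure.pi fun _ : Fin m => ν) := by
    have hbase := ProbabilityTheory.hasSubgaussianMGF_of_mem_Icc (μ := ν) hf.aemeasurable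
      (Filter.Eventually.of_forall h01)
    have hmp := measurePreserving_eval (fun _ : Fin m => ν) i
    rw [← hmp.map_eq] at hbase
    have hcomp := ProbabilityTheory.HasSubgaussianMGF.of_map hmp.measurable.aemeasurable hbase
    rw [hmp.map_eq] at hcomp
    have hc : (‖(1 : ℝ) - 0‖₊ / 2) ^ 2 = 1 / 4 := by
      rw [sub_zero, nnnorm_one]
      norm_num
    rw [hc] at hcomp
    exact hcomp
  have hmain := ProbabilityTheory.HasSubgaussianMGF.measure_sum_ge_le_of_iIndepFun hindep
    (s := Finset.univ) (fun i _ => hsub i) (ε := δ * m) (by positivity)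
  refine hmain.trans (le_of_eq ?_)
  congr 1
  rcases Nat.eq_zero_or_pos m with rfl | hm
  · simp
  · have : (m : ℝ) ≠ 0 := by positivity
    simp
    field_simp
    ring

/-- Two-sided Hoeffding bound for the empirical mean of a `[0, 1]`-valued function. -/
theorem hoeffding_unit {α : Type*} [MeasurableSpace α] (ν : Measure α)
    [IsProbabilityMeasure ν] (m : ℕ) (f : α → ℝ) (hf : Measurable f)
    (h01 : ∀ x, f x ∈ Set.Icc (0 : ℝ) 1) {δ : ℝ} (hδ : 0 ≤ δ) :
    (Measure.pi fun _ : Fin m => ν).real {s | δ * m ≤ |∑ i, f (s i) - m * ∫ x, f x ∂ν|} ≤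
      2 * Real.exp (-(2 * m * δ ^ 2)) := by
  have hup := hoeffding_unit_upper ν m f hf h01 hδ
  have hlo := hoeffding_unit_upper ν m (fun x => 1 - f x) (measurable_const.sub hf)
    (fun x => ⟨by linarith [(h01 x).2], by linarith [(h01 x).1]⟩) hδ
  have hint : Integrable f ν :=
    Integrable.of_mem_Icc 0 1 hf.aemeasurable (Filter.Eventually.of_forall h01)
  have hsubset : {s : Fin m → α | δ * m ≤ |∑ i, f (s i) - m * ∫ x, f x ∂ν|} ⊆
      {s | δ * m ≤ ∑ i, (f (s i) - ∫ x, f x ∂ν)} ∪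
      {s | δ * m ≤ ∑ i, ((1 - f (s i)) - ∫ x, (1 - f x) ∂ν)} := by
    intro s hs
    rw [Set.mem_union, Set.mem_ofPred_eq, Set.mem_ofPred_eq, integral_sub (by simp) hint]
    simp only [Finset.sum_sub_distrib, Finset.sum_const, Finset.card_univ, Fintype.card_fin,
      nsmul_eq_mul, integral_const, probReal_univ, smul_eq_mul, mul_one]
    rcases le_abs.1 hs.out with h | h
    · exact Or.inl h
    · right; linarith
  calc _ ≤ _ := measureReal_mono hsubset
    _ ≤ _ := measureReal_union_le _ _
    _ ≤ _ := by linarith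

theorem isProbabilityMeasure_discMeasure {n : ℕ} (p : Fin n → ℝ) (h0 : ∀ x, 0 ≤ p x)
    (h1 : ∑ x, p x = 1) : IsProbabilityMeasure (discMeasure p) := by
  constructor
  simp [discMeasure, ← ENNReal.ofReal_sum_of_nonneg (fun x _ => h0 x), h1]

theorem integral_discMeasure {n : ℕ} (p : Fin n → ℝ) (h0 : ∀ x, 0 ≤ p x) (f : Fin n → ℝ) :
    ∫ x, f x ∂(discMeasure p) = ∑ x, p x * f x := by
  rw [discMeasure, integral_finsetSum_measure]
  · simp [integral_smul_measure, ENNReal.toReal_ofReal, h0]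
  · intro i _
    exact (integrable_dirac (by simp)).smul_measure (by simp)

/-- The empirical distribution of a sample. -/
noncomputable def empirical {n m : ℕ} (s : Fin m → Fin n) (x : Fin n) : ℝ :=
  (∑ i, if s i = x then 1 else 0) / m

theorem empirical_nonneg {n m : ℕ} (s : Fin m → Fin n) (x : Fin n) : 0 ≤ empirical s x := by
  unfold empirical
  positivity

theorem sum_empirical {n m : ℕ} (s : Fin m → Fin n) (S : Finset (Fin n)) :
    ∑ x ∈ S, empirical s x = (∑ i, if s i ∈ S then 1 else 0) / m := by
  unfold empirical
  rw [← Finset.sum_div, Finset.sum_comm]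
  simp

/-- Uniform deviation over a finite family of sets. -/
theorem uniform_deviation {n : ℕ} {J : Type*} [Fintype J] (p : Fin n → ℝ) (h0 : ∀ x, 0 ≤ p x)
    (h1 : ∑ x, p x = 1) (S : J → Finset (Fin n)) {m : ℕ} (hm : 0 < m) {δ : ℝ} (hδ : 0 ≤ δ)
    (hcard : Fintype.card J * (2 * Real.exp (-(2 * m * δ ^ 2))) ≤ 1 / 10) :
    (9 / 10 : ℝ≥0∞) ≤ (Measure.pi fun _ : Fin m => discMeasure p)
      {s | ∀ j, |∑ x ∈ S j, empirical s x - ∑ x ∈ S j, p x| ≤ δ} := by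
  have := isProbabilityMeasure_discMeasure p h0 h1
  set P := Measure.pi fun _ : Fin m => discMeasure p
  set G := {s : Fin m → Fin n | ∀ j, |∑ x ∈ S j, empirical s x - ∑ x ∈ S j, p x| ≤ δ}
  have hm' : (0 : ℝ) < m := by exact_mod_cast hm
  have hbad : P.real Gᶜ ≤ 1 / 10 := by
    have hsub : Gᶜ ⊆ ⋃ j, {s : Fin m → Fin n | δ * m ≤
        |∑ i, (if s i ∈ S j then (1 : ℝ) else 0) -
          m * ∫ x, (if x ∈ S j then (1 : ℝ) else 0) ∂(discMeasure p)|} := by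
      intro s hs
      simp only [G, Set.mem_compl_iff, Set.mem_ofPred_eq, not_forall, not_le] at hs
      obtain ⟨j, hj⟩ := hs
      refine Set.mem_iUnion.2 ⟨j, ?_⟩
      rw [Set.mem_ofPred_eq, integral_discMeasure p h0]
      rw [sum_empirical] at hj
      simp only [mul_ite, mul_one, mul_zero, Finset.sum_ite_mem, Finset.univ_inter]
      rw [show ∑ i, (if s i ∈ S j then (1 : ℝ) else 0) - m * ∑ x ∈ S j, p x =
        m * ((∑ i, if s i ∈ S j then (1 : ℝ) else 0) / m - ∑ x ∈ S j, p x) by field_simp,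
        abs_mul, abs_of_pos hm']
      nlinarith
    calc P.real Gᶜ ≤ _ := measureReal_mono hsub
      _ ≤ _ := measureReal_iUnion_fintype_le _
      _ ≤ ∑ _ : J, 2 * Real.exp (-(2 * m * δ ^ 2)) := by
        refine Finset.sum_le_sum fun j _ => ?_
        refine hoeffding_unit (discMeasure p) m (fun x => if x ∈ S j then (1 : ℝ) else 0)
          (Measurable.of_discrete) (fun x => ?_) hδ
        split_ifs <;> simp
      _ ≤ 1 / 10 := by simpa using hcard
  have hG : 9 / 10 ≤ P.real G := by
    have := probReal_compl_eq_one_sub (μ := P) (s := G) (MeasurableSet.of_discrete)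
    linarith
  calc (9 / 10 : ℝ≥0∞) = ENNReal.ofReal (9 / 10) := by
        rw [ENNReal.ofReal_div_of_pos (by norm_num)]; norm_num
    _ ≤ ENNReal.ofReal (P.real G) := ENNReal.ofReal_le_ofReal hG
    _ = P G := by simp [Measure.real]

/-- `f` is constant on every block of the partition of the ordered domain cut out by the
breakpoints `b`. -/
def RespectsCuts {n : ℕ} {ι β : Type*} (b : ι → ℕ) (f : Fin n → β) : Prop :=
  ∀ x y : Fin n, (∀ i, b i ≤ (x : ℕ) ↔ b i ≤ (y : ℕ)) → f x = f y

theorem IsFlat.exists_respectsCuts {n t : ℕ} {q : Fin n → ℝ} (h : IsFlat n t q) :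
    ∃ b : Fin (t + 1) → ℕ, RespectsCuts b q := by
  obtain ⟨b, c, -, hb0, hbn, hq⟩ := h
  refine ⟨b, fun x y hxy => ?_⟩
  have hex : ∃ i : Fin t, b i.castSucc ≤ (x : ℕ) ∧ (x : ℕ) < b i.succ := by
    by_contra! hcon
    have hall (j : Fin (t + 1)) : b j ≤ (x : ℕ) := by
      induction j using Fin.induction with
      | zero => simp [hb0]
      | succ i ih => exact hcon i ih
    have := hall (Fin.last t)
    omega
  obtain ⟨i, hi1, hi2⟩ := hex
  rw [hq i x hi1 hi2, hq i y ((hxy _).1 hi1) (by have := hxy i.succ; omega)]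

/-- Half-lines are covered, up to sets of mass at most `1 / K`, by `K + 1` sets. -/
theorem exists_threshold_cover {n : ℕ} (p : Fin n → ℝ) (h0 : ∀ x, 0 ≤ p x)
    (h1 : ∑ x, p x = 1) {K : ℕ} (hK : 0 < K) :
    ∃ D U : Fin (K + 1) → Finset (Fin n), (∀ j, ∑ x ∈ U j, p x ≤ 1 / K) ∧
      ∀ b : ℕ, ∃ j, ∀ x ∉ U j, (b ≤ (x : ℕ) ↔ x ∈ D j) := by
  have hK' : (0 : ℝ) < K := by exact_mod_cast hK
  set F : ℕ → ℝ := fun b => ∑ x ∈ Finset.univ.filter (fun x : Fin n => (x : ℕ) < b), p x with hF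
  have hF1 (b : ℕ) : F b ≤ 1 := by
    rw [← h1]
    exact Finset.sum_le_sum_of_subset_of_nonneg (Finset.filter_subset _ _) fun x _ _ => h0 x
  have hF0 (b : ℕ) : 0 ≤ F b := Finset.sum_nonneg fun x _ => h0 x
  set level : ℕ → ℕ := fun b => ⌊K * F b⌋₊ with hlevel
  have hlevel_le (b : ℕ) : level b ≤ K := by
    refine Nat.floor_le_of_le ?_
    nlinarith [hF1 b]
  have hcell (j : Fin (K + 1)) : ∃ D U : Finset (Fin n), ∑ x ∈ U, p x ≤ 1 / K ∧
      ∀ b ≤ n, level b = j → ∀ x ∉ U, (b ≤ (x : ℕ) ↔ x ∈ D) := by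
    set cls := (Finset.range (n + 1)).filter fun b => level b = j with hcls
    rcases cls.eq_empty_or_nonempty with he | hne
    · refine ⟨∅, ∅, by simp, fun b hb hj => ?_⟩
      have : b ∈ cls := by simp [hcls, hj]; omega
      simp [he] at this
    · have hlo := cls.min'_mem hne
      have hhi := cls.max'_mem hne
      set lo := cls.min' hne
      set hi := cls.max' hne
      have hlohi : lo ≤ hi := cls.min'_le _ hhi
      refine ⟨Finset.univ.filter fun x => lo ≤ (x : ℕ),
        Finset.univ.filter fun x => lo ≤ (x : ℕ) ∧ (x : ℕ) < hi, ?_, ?_⟩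
      · have hsplit : F hi = F lo +
            ∑ x ∈ Finset.univ.filter (fun x : Fin n => lo ≤ (x : ℕ) ∧ (x : ℕ) < hi), p x := by
          rw [hF, ← Finset.sum_union]
          · refine Finset.sum_congr ?_ fun _ _ => rfl
            ext x
            simp only [Finset.mem_filter, Finset.mem_univ, true_and, Finset.mem_union]
            omega
          · rw [Finset.disjoint_filter]
            intros
            omega
        have h2 : level lo = level hi := by
          rw [(Finset.mem_filter.1 hlo).2, (Finset.mem_filter.1 hhi).2]
        have h3 : (level lo : ℝ) ≤ K * F lo := Nat.floor_le (mul_nonneg hK'.le (hF0 _))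
        have h4 : K * F hi < level hi + 1 := Nat.lt_floor_add_one _
        rw [← h2] at h4
        rw [le_div_iff₀ hK']
        nlinarith
      · intro b hb hj x hx
        have hmem : b ∈ cls := by simp [hcls, hj]; omega
        have h5 : lo ≤ b := cls.min'_le _ hmem
        have h6 : b ≤ hi := cls.le_max' _ hmem
        simp only [Finset.mem_filter, Finset.mem_univ, true_and] at hx ⊢
        omega
  choose D U hU hD using hcell
  refine ⟨D, U, hU, fun b => ⟨⟨level (min b n), Nat.lt_succ_of_le (hlevel_le _)⟩, ?_⟩⟩
  intro x hx
  rw [← hD _ (min b n) (min_le_right _ _) rfl x hx]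
  have := x.2
  omega

/-- A set respecting the cuts `b` is determined by counting the breakpoints to the left of a
point. -/
theorem RespectsCuts.exists_count {n : ℕ} {ι : Type*} [Fintype ι] {b : ι → ℕ}
    {A : Finset (Fin n)} (hA : RespectsCuts b (· ∈ A)) :
    ∃ T : Finset (Fin (Fintype.card ι + 1)), ∀ x : Fin n, x ∈ A ↔
      (⟨(Finset.univ.filter fun i => b i ≤ (x : ℕ)).card,
        Nat.lt_succ_of_le (Finset.card_le_univ _)⟩ : Fin (Fintype.card ι + 1)) ∈ T := by
  refine ⟨A.image fun x : Fin n => ⟨(Finset.univ.filter fun i => b i ≤ (x : ℕ)).card,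
    Nat.lt_succ_of_le (Finset.card_le_univ _)⟩, fun x => ?_⟩
  have hcount {u v : Fin n} (huv : u ≤ v)
      (h : (Finset.univ.filter fun i => b i ≤ (u : ℕ)).card =
        (Finset.univ.filter fun i => b i ≤ (v : ℕ)).card) : u ∈ A ↔ v ∈ A := by
    have huv' : (u : ℕ) ≤ v := huv
    have hsub : (Finset.univ.filter fun i => b i ≤ (u : ℕ)) ⊆
        Finset.univ.filter fun i => b i ≤ (v : ℕ) := by
      intro i hi
      simp only [Finset.mem_filter, Finset.mem_univ, true_and] at hi ⊢
      omega
    have heq := Finset.eq_of_subset_of_card_le hsub h.ge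
    refine Iff.of_eq (hA u v fun i => ?_)
    simpa using Finset.ext_iff.1 heq i
  constructor
  · intro hx
    exact Finset.mem_image_of_mem _ hx
  · intro hx
    obtain ⟨y, hy, hxy⟩ := Finset.mem_image.1 hx
    have hxy' := Fin.mk.inj_iff.1 hxy
    rcases le_total x y with h | h
    · exact (hcount h hxy'.symm).2 hy
    · exact (hcount h hxy').1 hy

theorem abs_sum_sub_sum_le_sum {n : ℕ} {f : Fin n → ℝ} (hf : ∀ x, 0 ≤ f x)
    {A B U : Finset (Fin n)} (h : ∀ x ∉ U, (x ∈ A ↔ x ∈ B)) :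
    |∑ x ∈ A, f x - ∑ x ∈ B, f x| ≤ ∑ x ∈ U, f x := by
  have hind (S : Finset (Fin n)) : ∑ x ∈ S, f x = ∑ x, if x ∈ S then f x else 0 := by simp
  rw [hind A, hind B, hind U, ← Finset.sum_sub_distrib]
  refine (Finset.abs_sum_le_sum_abs _ _).trans (Finset.sum_le_sum fun x _ => ?_)
  have := h x
  have := hf x
  by_cases hU : x ∈ U <;> by_cases hA : x ∈ A <;> by_cases hB : x ∈ B <;>
    simp_all [abs_of_nonneg]

theorem sum_biUnion_le_sum {n : ℕ} {ι : Type*} [Fintype ι] {f : Fin n → ℝ}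
    (hf : ∀ x, 0 ≤ f x) (U : ι → Finset (Fin n)) :
    ∑ x ∈ Finset.univ.biUnion U, f x ≤ ∑ i, ∑ x ∈ U i, f x := by
  have hind (S : Finset (Fin n)) : ∑ x ∈ S, f x = ∑ x, if x ∈ S then f x else 0 := by simp
  simp_rw [hind]
  rw [Finset.sum_comm]
  refine Finset.sum_le_sum fun x _ => ?_
  have hnn (i : ι) (_ : i ∈ Finset.univ) : 0 ≤ if x ∈ U i then f x else 0 := by
    split_ifs <;> simp [hf]
  split_ifs with hx
  · obtain ⟨i, hi, hxi⟩ := Finset.mem_biUnion.1 hx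
    calc f x = if x ∈ U i then f x else 0 := by simp [hxi]
      _ ≤ _ := Finset.single_le_sum hnn hi
  · exact Finset.sum_nonneg hnn

/-- If `e` approximates `p` on a suitable finite family of sets, depending on `p` only, then it
does so on all sets cut out by `Fintype.card ι` breakpoints. -/
theorem exists_finite_family_of_cuts {n : ℕ} (ι : Type*) [Fintype ι] (p : Fin n → ℝ)
    (h0 : ∀ x, 0 ≤ p x) (h1 : ∑ x, p x = 1) {K : ℕ} (hK : 0 < K) :
    ∃ S : (ι → Fin (K + 1)) × Option (Finset (Fin (Fintype.card ι + 1))) → Finset (Fin n),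
      ∀ (e : Fin n → ℝ) (δ : ℝ), (∀ x, 0 ≤ e x) →
        (∀ j, |∑ x ∈ S j, e x - ∑ x ∈ S j, p x| ≤ δ) →
        ∀ (b : ι → ℕ) (A : Finset (Fin n)), RespectsCuts b (· ∈ A) →
          |∑ x ∈ A, e x - ∑ x ∈ A, p x| ≤ 2 * δ + 2 * (Fintype.card ι / K) := by
  obtain ⟨D, U, hU, hD⟩ := exists_threshold_cover p h0 h1 hK
  set V : (ι → Fin (K + 1)) → Finset (Fin n) := fun j => Finset.univ.biUnion fun i => U (j i)
  set W : (ι → Fin (K + 1)) → Finset (Fin (Fintype.card ι + 1)) → Finset (Fin n) :=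
    fun j T => Finset.univ.filter fun x =>
      (⟨(Finset.univ.filter fun i => x ∈ D (j i)).card,
        Nat.lt_succ_of_le (Finset.card_le_univ _)⟩ : Fin (Fintype.card ι + 1)) ∈ T
  refine ⟨fun j => j.2.elim (V j.1) (W j.1), fun e δ he hdev b A hA => ?_⟩
  obtain ⟨T, hT⟩ := hA.exists_count
  choose j hj using fun i => hD (b i)
  have hVp : ∑ x ∈ V j, p x ≤ Fintype.card ι / K := by
    calc ∑ x ∈ V j, p x ≤ ∑ i, ∑ x ∈ U (j i), p x := sum_biUnion_le_sum h0 _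
      _ ≤ ∑ _i : ι, (1 / K : ℝ) := Finset.sum_le_sum fun i _ => hU _
      _ = Fintype.card ι / K := by simp [div_eq_mul_inv]
  have hAW : ∀ x ∉ V j, (x ∈ A ↔ x ∈ W j T) := by
    intro x hx
    have hx' (i : ι) : b i ≤ (x : ℕ) ↔ x ∈ D (j i) := by
      refine hj i x fun hxi => hx ?_
      exact Finset.mem_biUnion.2 ⟨i, Finset.mem_univ _, hxi⟩
    simp only [hT, W, hx', Finset.mem_filter, Finset.mem_univ, true_and]
  have hV := hdev (j, none)
  have hW := hdev (j, some T)
  simp only [Option.elim_none, Option.elim_some] at hV hW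
  have hp := abs_sum_sub_sum_le_sum h0 hAW
  have he' := abs_sum_sub_sum_le_sum he hAW
  rw [abs_le] at *
  constructor <;> linarith [hV.1, hV.2, hW.1, hW.2, hp.1, hp.2, he'.1, he'.2]

theorem abs_sum_sub_le_tv {n : ℕ} {p q : Fin n → ℝ} (hp : ∑ x, p x = 1) (hq : ∑ x, q x = 1)
    (A : Finset (Fin n)) :
    |∑ x ∈ A, p x - ∑ x ∈ A, q x| ≤ (1 / 2) * ∑ x, |p x - q x| := by
  have hsplitp := Finset.sum_add_sum_compl A p
  have hsplitq := Finset.sum_add_sum_compl A q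
  have hsplit := Finset.sum_add_sum_compl A fun x => |p x - q x|
  have h1 := Finset.abs_sum_le_sum_abs (fun x => p x - q x) A
  have h2 := Finset.abs_sum_le_sum_abs (fun x => p x - q x) Aᶜ
  rw [Finset.sum_sub_distrib] at h1 h2
  rw [show ∑ x ∈ Aᶜ, p x - ∑ x ∈ Aᶜ, q x = -(∑ x ∈ A, p x - ∑ x ∈ A, q x) by linarith,
    abs_neg] at h2
  linarith

/-- The total variation distance of two distributions respecting cuts is witnessed by a set
respecting the union of the cuts. -/
theorem RespectsCuts.tv_le {n : ℕ} {ι κ : Type*} {b : ι → ℕ} {b' : κ → ℕ} {p q : Fin n → ℝ}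
    (hp : RespectsCuts b p) (hq : RespectsCuts b' q) (hp1 : ∑ x, p x = 1)
    (hq1 : ∑ x, q x = 1) {D : ℝ}
    (hD : ∀ A : Finset (Fin n), RespectsCuts (Sum.elim b b') (· ∈ A) →
      |∑ x ∈ A, p x - ∑ x ∈ A, q x| ≤ D) :
    (1 / 2) * ∑ x, |p x - q x| ≤ D := by
  set A : Finset (Fin n) := Finset.univ.filter fun x => q x < p x with hA
  have hcut : RespectsCuts (Sum.elim b b') (· ∈ A) := by
    intro x y hxy
    have h1 := hp x y fun i => hxy (Sum.inl i)
    have h2 := hq x y fun i => hxy (Sum.inr i)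
    simp [hA, h1, h2]
  have hle := (le_abs_self _).trans (hD A hcut)
  have hsplitp := Finset.sum_add_sum_compl A p
  have hsplitq := Finset.sum_add_sum_compl A q
  have hsplit := Finset.sum_add_sum_compl A fun x => |p x - q x|
  have hpos : ∑ x ∈ A, |p x - q x| = ∑ x ∈ A, p x - ∑ x ∈ A, q x := by
    rw [← Finset.sum_sub_distrib]
    refine Finset.sum_congr rfl fun x hx => abs_of_pos ?_
    have := (Finset.mem_filter.1 hx).2
    linarith
  have hneg : ∑ x ∈ Aᶜ, |p x - q x| = ∑ x ∈ Aᶜ, q x - ∑ x ∈ Aᶜ, p x := by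
    rw [← Finset.sum_sub_distrib]
    refine Finset.sum_congr rfl fun x hx => ?_
    have : ¬ q x < p x := by simpa [hA] using hx
    rw [abs_of_nonpos (by linarith)]
    ring
  linarith

theorem tv_le_one {n : ℕ} {p q : Fin n → ℝ} (hp : ∀ x, 0 ≤ p x) (hq : ∀ x, 0 ≤ q x)
    (hp1 : ∑ x, p x = 1) (hq1 : ∑ x, q x = 1) : (1 / 2) * ∑ x, |p x - q x| ≤ 1 := by
  have : ∑ x, |p x - q x| ≤ ∑ x, (p x + q x) := Finset.sum_le_sum fun x _ => by
    rw [abs_le]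
    constructor <;> linarith [hp x, hq x]
  rw [Finset.sum_add_distrib] at this
  linarith

/-- A mixture of `k` distributions close to `t`-flat ones is close to a distribution cut out by
`k * (t + 1)` breakpoints. -/
theorem exists_respectsCuts_near_mixture {n k t : ℕ} {τ : ℝ} {p : Fin n → ℝ} {w : Fin k → ℝ}
    {pc : Fin k → Fin n → ℝ} (hw : ∀ j, 0 ≤ w j) (hw1 : ∑ j, w j = 1)
    (hpc : ∀ j, ∃ q : Fin n → ℝ, (∀ x, 0 ≤ q x) ∧ (∑ x, q x) = 1 ∧
      IsFlat n t q ∧ (1 / 2) * (∑ x, |pc j x - q x|) ≤ τ)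
    (hp : ∀ x, p x = ∑ j, w j * pc j x) :
    ∃ q : Fin n → ℝ, (∀ x, 0 ≤ q x) ∧ (∑ x, q x) = 1 ∧
      (∃ b : Fin k × Fin (t + 1) → ℕ, RespectsCuts b q) ∧
      (1 / 2) * (∑ x, |p x - q x|) ≤ τ := by
  choose q hq0 hq1 hflat hqτ using hpc
  choose b hb using fun j => (hflat j).exists_respectsCuts
  refine ⟨fun x => ∑ j, w j * q j x, fun x => Finset.sum_nonneg fun j _ =>
    mul_nonneg (hw j) (hq0 j x), ?_, ⟨fun i => b i.1 i.2, fun x y hxy => ?_⟩, ?_⟩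
  · rw [Finset.sum_comm]
    simp [← Finset.mul_sum, hq1, hw1]
  · exact Finset.sum_congr rfl fun j _ => by rw [hb j x y fun i => hxy (j, i)]
  · calc (1 / 2) * ∑ x, |p x - ∑ j, w j * q j x|
        ≤ (1 / 2) * ∑ x, ∑ j, w j * |pc j x - q j x| := by
          gcongr with x
          rw [hp, ← Finset.sum_sub_distrib]
          refine (Finset.abs_sum_le_sum_abs _ _).trans (le_of_eq ?_)
          refine Finset.sum_congr rfl fun j _ => ?_
          rw [← mul_sub, abs_mul, abs_of_nonneg (hw j)]
      _ = ∑ j, w j * ((1 / 2) * ∑ x, |pc j x - q j x|) := by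
          rw [Finset.sum_comm, Finset.mul_sum]
          refine Finset.sum_congr rfl fun j _ => ?_
          rw [← Finset.mul_sum]
          ring
      _ ≤ ∑ j, w j * τ := Finset.sum_le_sum fun j _ => mul_le_mul_of_nonneg_left (hqτ j) (hw j)
      _ = τ := by rw [← Finset.sum_mul, hw1, one_mul]

/-- `h` is a distribution cut out by breakpoints indexed by `ι` whose mass on every set cut out
by twice as many breakpoints is within `D` of that of `e`. -/
def IsCutFit {n : ℕ} (ι : Type*) (D : ℝ) (e h : Fin n → ℝ) : Prop :=
  (∀ x, 0 ≤ h x) ∧ (∑ x, h x) = 1 ∧ (∃ b : ι → ℕ, RespectsCuts b h) ∧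
    ∀ (b : ι ⊕ ι → ℕ) (A : Finset (Fin n)), RespectsCuts b (· ∈ A) →
      |∑ x ∈ A, e x - ∑ x ∈ A, h x| ≤ D

theorem IsCutFit.tv_le {n : ℕ} {ι : Type*} {D : ℝ} {e h q : Fin n → ℝ}
    (hh : IsCutFit ι D e h) (hq : IsCutFit ι D e q) :
    (1 / 2) * ∑ x, |q x - h x| ≤ 2 * D := by
  obtain ⟨-, hh1, ⟨b, hb⟩, hhD⟩ := hh
  obtain ⟨-, hq1, ⟨b', hb'⟩, hqD⟩ := hq
  refine hb'.tv_le hb hq1 hh1 fun A hA => ?_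
  have h1 := abs_le.1 (hhD _ A hA)
  have h2 := abs_le.1 (hqD _ A hA)
  rw [abs_le]
  constructor <;> linarith [h1.1, h1.2, h2.1, h2.2]

open Classical in
/-- The minimum distance learner: output some distribution fitting the empirical one. -/
noncomputable def cutLearner {n m : ℕ} (ι : Type*) (D : ℝ) (s : Fin m → Fin n) : Fin n → ℝ :=
  if h : ∃ q, IsCutFit ι D (empirical s) q then h.choose else 0

theorem isCutFit_cutLearner {n m : ℕ} {ι : Type*} {D : ℝ} {s : Fin m → Fin n} {q : Fin n → ℝ}
    (h : IsCutFit ι D (empirical s) q) : IsCutFit ι D (empirical s) (cutLearner ι D s) := by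
  have hex : ∃ q, IsCutFit ι D (empirical s) q := ⟨q, h⟩
  rw [cutLearner, dif_pos hex]
  exact hex.choose_spec

/-- A choice of sample size and grid resolution for which the union bound succeeds. -/
theorem exists_sample_size {k t : ℕ} (hk : 1 ≤ k) (ht : 1 ≤ t) {ε : ℝ} (hε : 0 < ε)
    (hε2 : ε < 1 / 2) :
    ∃ m K : ℕ, 0 < m ∧ 0 < K ∧ (m : ℝ) ≤ 20 * k * t * Real.log ((k : ℝ) * t / ε) / ε ^ 2 ∧
      ((2 * (k * (t + 1)) : ℕ) : ℝ) / K ≤ ε ∧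
      ((K + 1 : ℝ) ^ (2 * (k * (t + 1))) * (2 ^ (2 * (k * (t + 1)) + 1) + 1)) *
        (2 * Real.exp (-(2 * m * ε ^ 2))) ≤ 1 / 10 := by
  set L := 2 * (k * (t + 1)) with hL
  set R : ℝ := (k : ℝ) * t / ε with hR
  have hk' : (1 : ℝ) ≤ k := by exact_mod_cast hk
  have ht' : (1 : ℝ) ≤ t := by exact_mod_cast ht
  have hkt : (1 : ℝ) ≤ k * t := one_le_mul_of_one_le_of_one_le hk' ht'
  have hR2 : 2 ≤ R := by
    rw [hR, le_div_iff₀ hε]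
    linarith
  have hL4 : (4 : ℝ) ≤ L := by
    have : 4 ≤ L := by nlinarith
    exact_mod_cast this
  have hLkt : (L : ℝ) ≤ 4 * (k * t) := by
    rw [hL]
    push_cast
    nlinarith
  have hlog2 : Real.log 2 ≤ Real.log R := Real.log_le_log (by norm_num) hR2
  have hlog2' : (1 / 2 : ℝ) < Real.log 2 := by linarith [Real.log_two_gt_d9]
  have hlogR : 0 < Real.log R := by linarith
  set K := ⌈(L : ℝ) / ε⌉₊ with hK
  have hLε : 0 < (L : ℝ) / ε := by positivity
  have hKpos : 0 < K := Nat.ceil_pos.2 hLε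
  have hKge : (L : ℝ) / ε ≤ K := Nat.le_ceil _
  have hKlt : (K : ℝ) < L / ε + 1 := Nat.ceil_lt_add_one hLε.le
  have hKR : (K : ℝ) + 1 ≤ R ^ 5 := by
    have h1 : (L : ℝ) / ε ≤ 4 * R := by
      rw [hR, ← mul_div_assoc]
      gcongr
    have h16 : 16 ≤ R ^ 4 := by
      calc (16 : ℝ) = 2 ^ 4 := by norm_num
        _ ≤ R ^ 4 := by gcongr
    nlinarith
  set m := ⌈18 * (k * t) * Real.log R / ε ^ 2⌉₊ with hm
  have hmreal : 0 < 18 * (k * t : ℝ) * Real.log R / ε ^ 2 := by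
    positivity
  have hmge : 18 * (k * t : ℝ) * Real.log R / ε ^ 2 ≤ m := Nat.le_ceil _
  refine ⟨m, K, Nat.ceil_pos.2 hmreal, hKpos, ?_, ?_, ?_⟩
  · have h1 : (m : ℝ) < 18 * (k * t) * Real.log R / ε ^ 2 + 1 := Nat.ceil_lt_add_one hmreal.le
    have h2 : 1 ≤ 2 * (k * t) * Real.log R / ε ^ 2 := by
      rw [le_div_iff₀ (by positivity)]
      nlinarith
    have h3 : 20 * (k : ℝ) * t * Real.log R / ε ^ 2 =
      18 * (k * t) * Real.log R / ε ^ 2 + 2 * (k * t) * Real.log R / ε ^ 2 := by ring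
    linarith
  · rw [div_le_iff₀ (by positivity)]
    rwa [div_le_iff₀ hε, mul_comm] at hKge
  · have hexp : 18 * (k * t : ℝ) * Real.log R ≤ m * ε ^ 2 := by
      rwa [div_le_iff₀ (by positivity)] at hmge
    have hK5 : Real.log ((K : ℝ) + 1) ≤ 5 * Real.log R := by
      calc Real.log ((K : ℝ) + 1) ≤ Real.log (R ^ 5) := Real.log_le_log (by positivity) hKR
        _ = 5 * Real.log R := by rw [Real.log_pow]; norm_num
    have h2pow : (2 : ℝ) ^ (L + 1) + 1 ≤ 2 ^ (L + 2) := by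
      have : (1 : ℝ) ≤ 2 ^ (L + 1) := one_le_pow₀ (by norm_num)
      rw [pow_succ 2 (L + 1)]
      linarith
    have hbound : (K + 1 : ℝ) ^ L * 2 ^ (L + 7) ≤ Real.exp (2 * m * ε ^ 2) := by
      rw [← Real.log_le_iff_le_exp (by positivity), Real.log_mul (by positivity) (by positivity),
        Real.log_pow, Real.log_pow]
      push_cast
      have h1 : (L : ℝ) * Real.log (K + 1) ≤ L * (5 * Real.log R) := by gcongr
      have h2 : ((L : ℝ) + 7) * Real.log 2 ≤ (L + 7) * Real.log R := by gcongr
      have h3 : (L + 7 : ℝ) * Real.log R ≤ (3 * L) * Real.log R := by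
        gcongr
        linarith
      have h4 : (L : ℝ) * Real.log R ≤ 4 * (k * t) * Real.log R := by gcongr
      linarith
    rw [Real.exp_neg]
    have hE := Real.exp_pos (2 * m * ε ^ 2)
    rw [← mul_assoc, ← div_eq_mul_inv, div_le_iff₀ hE]
    calc (K + 1 : ℝ) ^ L * (2 ^ (L + 1) + 1) * 2 ≤ (K + 1 : ℝ) ^ L * 2 ^ (L + 2) * 2 := by gcongr
      _ ≤ 1 / 10 * ((K + 1 : ℝ) ^ L * 2 ^ (L + 7)) := by
        have : 0 ≤ (K + 1 : ℝ) ^ L * 2 ^ L := by positivity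
        rw [pow_add, pow_add]
        linarith
      _ ≤ _ := by gcongr

/-- Theorem thm:opt-discrete: learning k-mixtures of (τ,t)-flat discrete
distributions over the 2N-point domain with Õ(kt/ε²) samples. -/
theorem learn_flat_discrete_mixtures :
    ∃ C c : ℝ, 0 < C ∧ 0 < c ∧
      ∀ k t N : ℕ, 1 ≤ k → 1 ≤ t → 1 ≤ N →
      ∀ ε τ : ℝ, 0 < ε → ε < 1 → 0 ≤ τ →
        ∃ (m : ℕ) (A : (Fin m → Fin (2 * N)) → (Fin (2 * N) → ℝ)),
          (m : ℝ) ≤ C * k * t * (Real.log ((k : ℝ) * t / ε)) ^ c / ε ^ 2 ∧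
          Measurable A ∧
          ∀ p : Fin (2 * N) → ℝ,
            (∃ (w : Fin k → ℝ) (pc : Fin k → Fin (2 * N) → ℝ),
              (∀ j, 0 ≤ w j) ∧ (∑ j, w j) = 1 ∧
              (∀ j, (∀ x, 0 ≤ pc j x) ∧ (∑ x, pc j x) = 1 ∧
                ∃ q : Fin (2 * N) → ℝ, (∀ x, 0 ≤ q x) ∧ (∑ x, q x) = 1 ∧
                  IsFlat (2 * N) t q ∧ (1 / 2) * (∑ x, |pc j x - q x|) ≤ τ) ∧
              ∀ x, p x = ∑ j, w j * pc j x) →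
            (9 / 10 : ℝ≥0∞) ≤ (Measure.pi fun _ : Fin m => discMeasure p)
              {s | (∀ x, 0 ≤ A s x) ∧ (∑ x, A s x) = 1 ∧
                   (1 / 2) * (∑ x, |p x - A s x|) ≤ C * (ε + τ)} := by
  refine ⟨20, 1, by norm_num, by norm_num, fun k t N hk ht hN ε τ hε hε1 hτ => ?_⟩
  simp only [Real.rpow_one]
  have hdist (p : Fin (2 * N) → ℝ) (w : Fin k → ℝ) (pc : Fin k → Fin (2 * N) → ℝ)
      (hw : ∀ j, 0 ≤ w j) (hw1 : ∑ j, w j = 1)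
      (hpc : ∀ j, (∀ x, 0 ≤ pc j x) ∧ ∑ x, pc j x = 1)
      (hp : ∀ x, p x = ∑ j, w j * pc j x) : (∀ x, 0 ≤ p x) ∧ ∑ x, p x = 1 := by
    constructor
    · intro x
      rw [hp]
      exact Finset.sum_nonneg fun j _ => mul_nonneg (hw j) ((hpc j).1 x)
    · simp only [hp]
      rw [Finset.sum_comm]
      simp [← Finset.mul_sum, (hpc _).2, hw1]
  rcases le_or_gt (1 / 2) ε with hlarge | hsmall
  · refine ⟨0, fun _ => Pi.single ⟨0, by omega⟩ 1, ?_, Measurable.of_discrete, ?_⟩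
    · have hkt : (1 : ℝ) ≤ k * t := by exact_mod_cast Nat.mul_pos hk ht
      have : 0 ≤ Real.log ((k : ℝ) * t / ε) :=
        Real.log_nonneg (by rw [le_div_iff₀ hε]; linarith)
      rw [Nat.cast_zero]
      positivity
    · rintro p ⟨w, pc, hw, hw1, hpc, hp⟩
      obtain ⟨hp0, hp1⟩ := hdist p w pc hw hw1 (fun j => ⟨(hpc j).1, (hpc j).2.1⟩) hp
      have := isProbabilityMeasure_discMeasure p hp0 hp1
      have hs0 : ∀ x, 0 ≤ (Pi.single ⟨0, by omega⟩ 1 : Fin (2 * N) → ℝ) x := by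
        intro x
        rw [Pi.single_apply]
        split_ifs <;> norm_num
      have hs1 : ∑ x, (Pi.single ⟨0, by omega⟩ 1 : Fin (2 * N) → ℝ) x = 1 := by simp
      have htv := tv_le_one hp0 hs0 hp1 hs1
      refine le_trans ?_ (measure_mono (s := Set.univ) fun s _ => ⟨hs0, hs1, by linarith⟩)
      rw [measure_univ]
      exact ENNReal.div_le_of_le_mul (by norm_num)
  · obtain ⟨m, K, hm, hK, hmle, hLK, hcard⟩ := exists_sample_size hk ht hε hsmall
    refine ⟨m, cutLearner (Fin k × Fin (t + 1)) (4 * ε + τ), hmle, Measurable.of_discrete, ?_⟩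
    rintro p ⟨w, pc, hw, hw1, hpc, hp⟩
    obtain ⟨hp0, hp1⟩ := hdist p w pc hw hw1 (fun j => ⟨(hpc j).1, (hpc j).2.1⟩) hp
    obtain ⟨q, hq0, hq1, hqcut, hqτ⟩ :=
      exists_respectsCuts_near_mixture hw hw1 (fun j => (hpc j).2.2) hp
    obtain ⟨S, hS⟩ := exists_finite_family_of_cuts
      ((Fin k × Fin (t + 1)) ⊕ (Fin k × Fin (t + 1))) p hp0 hp1 hK
    have hL : Fintype.card ((Fin k × Fin (t + 1)) ⊕ (Fin k × Fin (t + 1))) =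
        2 * (k * (t + 1)) := by
      simp [two_mul]
    refine (uniform_deviation p hp0 hp1 S hm hε.le ?_).trans (measure_mono fun s hs => ?_)
    · convert hcard using 2
      rw [Fintype.card_prod, Fintype.card_fun, Fintype.card_option, Fintype.card_finset, hL]
      simp
    · have hqfit : IsCutFit (Fin k × Fin (t + 1)) (4 * ε + τ) (empirical s) q := by
        refine ⟨hq0, hq1, hqcut, fun b A hA => ?_⟩
        have h1 := hS (empirical s) ε (empirical_nonneg s) hs b A hA
        rw [hL] at h1
        have h2 := abs_sum_sub_le_tv hp1 hq1 A
        have h3 := abs_sub_le (∑ x ∈ A, empirical s x) (∑ x ∈ A, p x) (∑ x ∈ A, q x)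
        linarith
      have hfit := isCutFit_cutLearner hqfit
      refine ⟨hfit.1, hfit.2.1, ?_⟩
      have htv := hfit.tv_le hqfit
      have htri : ∑ x, |p x - cutLearner (Fin k × Fin (t + 1)) (4 * ε + τ) s x| ≤
          ∑ x, |p x - q x| + ∑ x, |q x - cutLearner (Fin k × Fin (t + 1)) (4 * ε + τ) s x| := by
        rw [← Finset.sum_add_distrib]
        exact Finset.sum_le_sum fun x _ => abs_sub_le _ _ _
      linarith
end

section
/- There exist universal constants C, c₁, c₂ > 0 such that for every κ ∈ (0,1) the following holds. With m = ⌈C·(1/κ)·log(1/κ)⌉, there is a measurable map taking m points of [−1,1) to a partition of [−1,1) into ℓ intervals with c₁/κ ≤ ℓ ≤ c₂/κ, such that for every κ/64-well-behaved probability distribution p over [−1,1): with probability at least 99/100 over m i.i.d. samples drawn from p, the resulting partition {I₁,…,I_ℓ} satisfies p(I_j) ∈ [κ/2, 3κ] for all 1 ≤ j ≤ ℓ. (Lemma lem:part-approx-unif, procedure Approximately-Equal-Partition.) -/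
open MeasureTheory Set
open scoped ENNReal

/-- `x` is a `u`-quantile of `μ`. -/
def IsQuantile (μ : Measure ℝ) (u x : ℝ) : Prop :=
  μ.real (Iio x) ≤ u ∧ u ≤ μ.real (Iic x)

/-- The lower `u`-quantile of `μ`. -/
noncomputable def lowerQuantile (μ : Measure ℝ) (u : ℝ) : ℝ :=
  sInf {t | u ≤ μ.real (Iic t)}

lemma lowerQuantile_le_iff (μ : Measure ℝ) [IsProbabilityMeasure μ] {u : ℝ} (hu₀ : 0 < u)
    (hu₁ : u < 1) (t : ℝ) : lowerQuantile μ u ≤ t ↔ u ≤ μ.real (Iic t) := by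
  have hmono : ∀ {a b : ℝ}, a ≤ b → μ.real (Iic a) ≤ μ.real (Iic b) := fun h =>
    measureReal_mono (Iic_subset_Iic.2 h)
  have hne : {t | u ≤ μ.real (Iic t)}.Nonempty := by
    obtain ⟨t, ht⟩ := ((ProbabilityTheory.tendsto_cdf_atTop μ).eventually
      (lt_mem_nhds hu₁)).exists
    exact ⟨t, by rw [ProbabilityTheory.cdf_eq_real] at ht; exact ht.le⟩
  have hbdd : BddBelow {t | u ≤ μ.real (Iic t)} := by
    obtain ⟨b, hb⟩ := ((ProbabilityTheory.tendsto_cdf_atBot μ).eventually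
      (gt_mem_nhds hu₀)).exists
    rw [ProbabilityTheory.cdf_eq_real] at hb
    refine ⟨b, fun t ht => le_of_not_gt fun hlt => ?_⟩
    exact absurd (le_trans ht (hmono hlt.le)) (not_le.2 hb)
  refine ⟨fun h => le_trans ?_ (hmono h), fun h => csInf_le hbdd h⟩
  rw [← ProbabilityTheory.cdf_eq_real]
  have hcont := ((ProbabilityTheory.cdf μ).right_continuous (lowerQuantile μ u)).mono_left
    (nhdsWithin_mono _ Ioi_subset_Ici_self)
  refine ge_of_tendsto hcont ?_
  filter_upwards [self_mem_nhdsWithin] with b hb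
  obtain ⟨s, hs, hsb⟩ := exists_lt_of_csInf_lt hne hb
  rw [ProbabilityTheory.cdf_eq_real]
  exact le_trans hs (hmono hsb.le)

lemma isQuantile_lowerQuantile (μ : Measure ℝ) [IsProbabilityMeasure μ] {u : ℝ} (hu₀ : 0 < u)
    (hu₁ : u < 1) : IsQuantile μ u (lowerQuantile μ u) := by
  refine ⟨?_, (lowerQuantile_le_iff μ hu₀ hu₁ _).1 le_rfl⟩
  have hlim := (ProbabilityTheory.cdf μ).mono.tendsto_leftLim (lowerQuantile μ u)
  have hle : Function.leftLim (ProbabilityTheory.cdf μ) (lowerQuantile μ u) ≤ u := by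
    refine le_of_tendsto hlim ?_
    filter_upwards [self_mem_nhdsWithin] with b hb
    rw [ProbabilityTheory.cdf_eq_real]
    exact (not_le.1 fun h => not_le.2 hb ((lowerQuantile_le_iff μ hu₀ hu₁ b).2 h)).le
  have hmeas := (ProbabilityTheory.cdf μ).measure_Iio (ProbabilityTheory.tendsto_cdf_atBot μ)
    (lowerQuantile μ u)
  rw [ProbabilityTheory.measure_cdf, sub_zero] at hmeas
  rw [measureReal_def, hmeas]
  exact ENNReal.toReal_le_of_le_ofReal hu₀.le (ENNReal.ofReal_le_ofReal hle)

/-- The points `a = x₀, x₁, …, x_n = b` in which `x_j` is the lower `j / n`-quantile of `μ`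
for `0 < j < n`. -/
noncomputable def quantilePoint (μ : Measure ℝ) (a b : ℝ) (n j : ℕ) : ℝ :=
  if j = 0 then a else if j < n then lowerQuantile μ (j / n) else b

lemma natCast_div_mem_Ioo {n j : ℕ} (h₀ : j ≠ 0) (h₁ : j < n) :
    (0 : ℝ) < j / n ∧ (j : ℝ) / n < 1 := by
  have hj : (0 : ℝ) < j := by exact_mod_cast Nat.pos_of_ne_zero h₀
  have hjn : (j : ℝ) < n := by exact_mod_cast h₁
  exact ⟨div_pos hj (hj.trans hjn), (div_lt_one (hj.trans hjn)).2 hjn⟩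

lemma measureReal_Iio_eq_zero_and_one {μ : Measure ℝ} [IsProbabilityMeasure μ] {a b : ℝ}
    (hab : a ≤ b) (h : μ (Ico a b) = 1) : μ.real (Iio a) = 0 ∧ μ.real (Iio b) = 1 := by
  have h' : μ.real (Ico a b) = 1 := by simp [measureReal_def, h]
  have hadd : μ.real (Iio a) + μ.real (Ico a b) = μ.real (Iio b) := by
    rw [← measureReal_union _ measurableSet_Ico, Iio_union_Ico_eq_Iio hab]
    exact disjoint_left.2 fun x hx hx' => not_le.2 hx hx'.1
  have := measureReal_le_one (μ := μ) (s := Iio b)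
  have := measureReal_nonneg (μ := μ) (s := Iio a)
  constructor <;> linarith

lemma isQuantile_quantilePoint {μ : Measure ℝ} [IsProbabilityMeasure μ] {a b : ℝ} (hab : a ≤ b)
    (h : μ (Ico a b) = 1) {n j : ℕ} (hn : n ≠ 0) (hj : j ≤ n) :
    IsQuantile μ (j / n) (quantilePoint μ a b n j) := by
  obtain ⟨ha, hb⟩ := measureReal_Iio_eq_zero_and_one hab h
  unfold quantilePoint
  split_ifs with h0 h1
  · subst h0
    simp [IsQuantile, ha]
  · exact isQuantile_lowerQuantile μ (natCast_div_mem_Ioo h0 h1).1 (natCast_div_mem_Ioo h0 h1).2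
  · obtain rfl : j = n := by omega
    have hn' : (j : ℝ) ≠ 0 := by exact_mod_cast hn
    rw [div_self hn']
    exact ⟨hb.le, hb.ge.trans (measureReal_mono Iio_subset_Iic_self)⟩

lemma lowerQuantile_mem_Icc {μ : Measure ℝ} [IsProbabilityMeasure μ] {a b : ℝ} (hab : a ≤ b)
    (h : μ (Ico a b) = 1) {u : ℝ} (hu₀ : 0 < u) (hu₁ : u < 1) :
    lowerQuantile μ u ∈ Icc a b := by
  obtain ⟨ha, hb⟩ := measureReal_Iio_eq_zero_and_one hab h
  constructor
  · refine le_of_not_gt fun hlt => ?_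
    have h1 := (lowerQuantile_le_iff μ hu₀ hu₁ _).1 le_rfl
    have h2 : μ.real (Iic (lowerQuantile μ u)) ≤ μ.real (Iio a) :=
      measureReal_mono (Iic_subset_Iio.2 hlt)
    linarith
  · rw [lowerQuantile_le_iff μ hu₀ hu₁]
    have : μ.real (Iio b) ≤ μ.real (Iic b) := measureReal_mono Iio_subset_Iic_self
    linarith

lemma quantilePoint_monotoneOn {μ : Measure ℝ} [IsProbabilityMeasure μ] {a b : ℝ} (hab : a ≤ b)
    (h : μ (Ico a b) = 1) (n : ℕ) : MonotoneOn (quantilePoint μ a b n) (Iic n) := by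
  intro i hi j hj hij
  simp only [mem_Iic] at hi hj
  unfold quantilePoint
  split_ifs with h1 h2 h3 h4 h5 h6 h7
  · exact le_rfl
  · exact (lowerQuantile_mem_Icc hab h (natCast_div_mem_Ioo h2 h3).1
      (natCast_div_mem_Ioo h2 h3).2).1
  · exact hab
  · omega
  · have hi' := natCast_div_mem_Ioo h1 h4
    have hj' := natCast_div_mem_Ioo h5 h6
    rw [lowerQuantile_le_iff μ hi'.1 hi'.2]
    refine le_trans ?_ ((lowerQuantile_le_iff μ hj'.1 hj'.2 _).1 le_rfl)
    gcongr
  · exact (lowerQuantile_mem_Icc hab h (natCast_div_mem_Ioo h1 h4).1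
      (natCast_div_mem_Ioo h1 h4).2).2
  · omega
  · omega
  · exact le_rfl

/-- The empirical measure of the sample `s`. -/
noncomputable def empiricalMeasure {m : ℕ} (s : Fin m → ℝ) : Measure ℝ :=
  (m : ℝ≥0∞)⁻¹ • ∑ i, Measure.dirac (s i)

lemma isProbabilityMeasure_empiricalMeasure {m : ℕ} (hm : m ≠ 0) (s : Fin m → ℝ) :
    IsProbabilityMeasure (empiricalMeasure s) := by
  constructor
  simp [empiricalMeasure, ENNReal.inv_mul_cancel, hm]

lemma empiricalMeasure_real {m : ℕ} (s : Fin m → ℝ) {J : Set ℝ} (hJ : MeasurableSet J) :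
    (empiricalMeasure s).real J = (m : ℝ)⁻¹ * ∑ i, J.indicator 1 (s i) := by
  simp only [empiricalMeasure, measureReal_def, Measure.smul_apply, Measure.finsetSum_apply,
    Measure.dirac_apply' _ hJ, smul_eq_mul, ENNReal.toReal_mul, ENNReal.toReal_inv,
    ENNReal.toReal_natCast]
  rw [ENNReal.toReal_sum]
  · congr 1
    refine Finset.sum_congr rfl fun i _ => ?_
    by_cases h : s i ∈ J <;> simp [h]
  · intro i _
    by_cases h : s i ∈ J <;> simp [h]

lemma measurable_quantilePoint_empiricalMeasure {m : ℕ} (hm : m ≠ 0) (a b : ℝ) (n j : ℕ) :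
    Measurable fun s : Fin m → ℝ => quantilePoint (empiricalMeasure s) a b n j := by
  unfold quantilePoint
  split_ifs with h0 h1
  · exact measurable_const
  · refine measurable_of_Iic fun t => ?_
    have hset : (fun s : Fin m → ℝ => lowerQuantile (empiricalMeasure s) (j / n)) ⁻¹' Iic t =
        {s | (j : ℝ) / n ≤ (m : ℝ)⁻¹ * ∑ i, (Iic t).indicator 1 (s i)} := by
      ext s
      have := isProbabilityMeasure_empiricalMeasure hm s
      rw [mem_preimage, mem_Iic, lowerQuantile_le_iff _ (natCast_div_mem_Ioo h0 h1).1
        (natCast_div_mem_Ioo h0 h1).2, empiricalMeasure_real _ measurableSet_Iic, mem_ofPred_eq]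
    rw [hset]
    refine measurableSet_le measurable_const (measurable_const.mul ?_)
    refine Finset.measurable_sum _ fun i _ => ?_
    exact (measurable_one.indicator measurableSet_Iic).comp (measurable_pi_apply i)
  · exact measurable_const

/-- The Chernoff bound for the number of samples that hit `J`, weighted by `t` of either sign. -/
lemma measureReal_pi_le_exp (p : Measure ℝ) [IsProbabilityMeasure p] (m : ℕ) {J : Set ℝ}
    (hJ : MeasurableSet J) (t a : ℝ) :
    (Measure.pi fun _ : Fin m => p).real {s | a ≤ t * ∑ i, J.indicator 1 (s i)} ≤
      Real.exp (m * (p.real J * (Real.exp t - 1)) - a) := by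
  have hexp : ∀ x, Real.exp (t * J.indicator 1 x) =
      1 + (Real.exp t - 1) * J.indicator 1 x := by
    intro x
    by_cases h : x ∈ J <;> simp [h]
  have hind : Measurable (J.indicator (1 : ℝ → ℝ)) := measurable_one.indicator hJ
  have hindI : Integrable (J.indicator (1 : ℝ → ℝ)) p := (integrable_const 1).indicator hJ
  have hfac : Integrable (fun x => Real.exp (t * J.indicator 1 x)) p := by
    simp only [hexp]
    exact (integrable_const _).add (hindI.const_mul _)
  have hprod : (fun s : Fin m → ℝ => Real.exp (1 * (t * ∑ i, J.indicator 1 (s i)))) =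
      fun s => ∏ i, Real.exp (t * J.indicator 1 (s i)) := by
    funext s
    rw [one_mul, Finset.mul_sum, Real.exp_sum]
  have hint : Integrable
      (fun s : Fin m → ℝ => Real.exp (1 * (t * ∑ i, J.indicator 1 (s i))))
      (Measure.pi fun _ : Fin m => p) := by
    rw [hprod]
    exact Integrable.fin_nat_prod fun _ => hfac
  refine (ProbabilityTheory.measure_ge_le_exp_mul_mgf a zero_le_one hint).trans ?_
  have hmgf : ProbabilityTheory.mgf (fun s : Fin m → ℝ => t * ∑ i, J.indicator 1 (s i))
      (Measure.pi fun _ : Fin m => p) 1 = (1 + (Real.exp t - 1) * p.real J) ^ m := by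
    rw [ProbabilityTheory.mgf, hprod,
      integral_fin_nat_prod_eq_prod (fun _ x => Real.exp (t * J.indicator 1 x))]
    simp only [hexp]
    rw [integral_add (integrable_const _) (hindI.const_mul _), integral_const_mul,
      integral_indicator_one hJ]
    simp
  have hbase : 0 ≤ 1 + (Real.exp t - 1) * p.real J := by
    have h1 := measureReal_le_one (μ := p) (s := J)
    have h2 := measureReal_nonneg (μ := p) (s := J)
    nlinarith [Real.exp_pos t]
  calc Real.exp (-1 * a) * _ ≤ Real.exp (-1 * a) * Real.exp ((Real.exp t - 1) * p.real J) ^ m := by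
        rw [hmgf]
        gcongr
        linarith [Real.add_one_le_exp ((Real.exp t - 1) * p.real J)]
    _ = _ := by
        rw [← Real.exp_nat_mul, ← Real.exp_add]
        ring_nf

lemma measureReal_Ico_eq_sub (μ : Measure ℝ) [IsProbabilityMeasure μ] {x y : ℝ} (hxy : x ≤ y) :
    μ.real (Ico x y) = μ.real (Iio y) - μ.real (Iio x) := by
  rw [eq_sub_iff_add_eq', ← measureReal_union _ measurableSet_Ico, Iio_union_Ico_eq_Iio hxy]
  exact disjoint_left.2 fun z hz hz' => not_le.2 hz hz'.1

/-- If the atoms of `μ` have mass at most `ε`, then every point lies in a cell of the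
`1 / N`-quantile grid of `μ`, and this cell has mass at most `1 / N + ε`. -/
lemma exists_quantilePoint_cell {μ : Measure ℝ} [IsProbabilityMeasure μ] {a b ε : ℝ}
    (hab : a ≤ b) (h : μ (Ico a b) = 1) (hatom : ∀ x, μ.real {x} ≤ ε) {N : ℕ} (hN : N ≠ 0)
    {z : ℝ} (hz : z ∈ Ico a b) :
    ∃ i < N, quantilePoint μ a b N i ≤ z ∧ z < quantilePoint μ a b N (i + 1) ∧
      μ.real (Iio (quantilePoint μ a b N (i + 1))) - μ.real (Iio (quantilePoint μ a b N i)) ≤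
        1 / N + ε := by
  classical
  set q := quantilePoint μ a b N
  have hq0 : q 0 ≤ z := by simpa [q, quantilePoint] using hz.1
  have hqN : z < q N := by simpa [q, quantilePoint, hN] using hz.2
  set i := Nat.findGreatest (fun j => q j ≤ z) N
  have hi : q i ≤ z := Nat.findGreatest_spec (P := fun j => q j ≤ z) (Nat.zero_le N) hq0
  have hiN : i < N := lt_of_le_of_ne (Nat.findGreatest_le N) fun he => by
    rw [he] at hi
    exact not_le.2 hqN hi
  have hi' : z < q (i + 1) := not_le.1
    (Nat.findGreatest_is_greatest (P := fun j => q j ≤ z) (Nat.lt_succ_self i) hiN)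
  refine ⟨i, hiN, hi, hi', ?_⟩
  have h1 := (isQuantile_quantilePoint hab h hN hiN.le).2
  have h2 := (isQuantile_quantilePoint hab h hN (Nat.succ_le_of_lt hiN)).1
  have h3 : μ.real (Iic (q i)) ≤ μ.real (Iio (q i)) + μ.real {q i} := by
    rw [← Iio_union_right]
    exact measureReal_union_le _ _
  have h4 := hatom (q i)
  have h5 : ((i + 1 : ℕ) : ℝ) / N = i / N + 1 / N := by
    push_cast
    ring
  rw [Nat.succ_eq_add_one, h5] at h2
  change (i : ℝ) / N ≤ μ.real (Iic (q i)) at h1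
  change μ.real (Iio (q (i + 1))) ≤ _ at h2
  linarith

/-- At scale `κ`, the mass of `J` under `ν` does not deviate too far from its mass under `μ`. -/
def IsAccurateOn (μ ν : Measure ℝ) (κ : ℝ) (J : Set ℝ) : Prop :=
  (μ.real J ≤ 9 / 16 * κ → ν.real J < κ) ∧ (47 / 16 * κ ≤ μ.real J → 4 / 3 * κ < ν.real J)

/-- If `ν` is accurate on all intervals spanned by a fine grid, then intervals between quantiles
of `ν` at distance about `κ` have mass of order `κ` under `μ`. -/
lemma measureReal_Ico_mem_Icc {μ ν : Measure ℝ} [IsProbabilityMeasure μ] [IsProbabilityMeasure ν]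
    {κ : ℝ} (hκ : 0 < κ) {N : ℕ} {q : ℕ → ℝ}
    (hgood : ∀ i ≤ N, ∀ j ≤ N, IsAccurateOn μ ν κ (Ico (q i) (q j))) {x y u v : ℝ}
    (hx : ∃ i < N, q i ≤ x ∧ x < q (i + 1) ∧ μ.real (Iio (q (i + 1))) - μ.real (Iio (q i)) ≤ κ / 32)
    (hy : ∃ i < N, q i ≤ y ∧ y < q (i + 1) ∧ μ.real (Iio (q (i + 1))) - μ.real (Iio (q i)) ≤ κ / 32)
    (hxy : x ≤ y) (hu : IsQuantile ν u x) (hv : IsQuantile ν v y) (huv₀ : κ ≤ v - u)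
    (huv₁ : v - u ≤ 4 / 3 * κ) :
    μ.real (Ico x y) ∈ Icc (κ / 2) (3 * κ) := by
  obtain ⟨i, hiN, hix, hxi, hi⟩ := hx
  obtain ⟨j, hjN, hjy, hyj, hj⟩ := hy
  have hIio : ∀ {ρ : Measure ℝ} [IsProbabilityMeasure ρ] {s t : ℝ}, s ≤ t →
      ρ.real (Iio s) ≤ ρ.real (Iio t) := fun hst => measureReal_mono (Iio_subset_Iio hst)
  have hIic : ∀ {ρ : Measure ℝ} [IsProbabilityMeasure ρ] {s t : ℝ}, s < t →
      ρ.real (Iic s) ≤ ρ.real (Iio t) := fun hst => measureReal_mono (Iic_subset_Iio.2 hst)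
  have hμ₁ := hIio (ρ := μ) hix
  have hμ₂ := hIio (ρ := μ) hxi.le
  have hμ₃ := hIio (ρ := μ) hjy
  have hμ₄ := hIio (ρ := μ) hyj.le
  have hle : q i ≤ q (j + 1) := hix.trans (hxy.trans hyj.le)
  rw [measureReal_Ico_eq_sub μ hxy]
  constructor
  · by_contra! hlt
    have h1 := (hgood i hiN.le (j + 1) hjN).1
    rw [measureReal_Ico_eq_sub μ hle, measureReal_Ico_eq_sub ν hle] at h1
    have h2 := h1 (by linarith)
    have h3 := hIio (ρ := ν) hix
    have h4 := hIic (ρ := ν) hyj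
    linarith [hu.1, hv.2]
  · by_contra! hlt
    rcases le_total (q (i + 1)) (q j) with hc | hc
    · have h1 := (hgood (i + 1) hiN j hjN.le).2
      rw [measureReal_Ico_eq_sub μ hc, measureReal_Ico_eq_sub ν hc] at h1
      have h2 := h1 (by linarith)
      have h3 := hIic (ρ := ν) hxi
      have h4 := hIio (ρ := ν) hjy
      linarith [hu.2, hv.1]
    · have := hIio (ρ := μ) hc
      linarith

lemma measureReal_pi_not_isAccurateOn_le (p : Measure ℝ) [IsProbabilityMeasure p] {m : ℕ}
    (hm : m ≠ 0) {κ : ℝ} (hκ : 0 < κ) {J : Set ℝ} (hJ : MeasurableSet J) :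
    (Measure.pi fun _ : Fin m => p).real {s | ¬ IsAccurateOn p (empiricalMeasure s) κ J} ≤
      Real.exp (-(m * κ / 16)) := by
  have hm' : (0 : ℝ) < m := by exact_mod_cast Nat.pos_of_ne_zero hm
  have hp := measureReal_nonneg (μ := p) (s := J)
  have hsum : ∀ s : Fin m → ℝ,
      ∑ i, J.indicator 1 (s i) = m * (empiricalMeasure s).real J := fun s => by
    rw [empiricalMeasure_real s hJ, mul_inv_cancel_left₀ hm'.ne']
  by_cases h1 : p.real J ≤ 9 / 16 * κ
  · have hsub : {s | ¬ IsAccurateOn p (empiricalMeasure s) κ J} ⊆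
        {s : Fin m → ℝ | m * κ / 2 ≤ 1 / 2 * ∑ i, J.indicator 1 (s i)} := by
      intro s hs
      have h2 : κ ≤ (empiricalMeasure s).real J := by
        by_contra! hlt
        exact hs ⟨fun _ => hlt, fun h => by linarith⟩
      change m * κ / 2 ≤ 1 / 2 * ∑ i, J.indicator 1 (s i)
      rw [hsum]
      nlinarith
    refine (measureReal_mono hsub).trans ((measureReal_pi_le_exp p m hJ _ _).trans ?_)
    have he := (abs_le.1 (Real.abs_exp_sub_one_sub_id_le (x := 1 / 2) (by norm_num))).2
    have h3 : p.real J * (Real.exp (1 / 2) - 1) ≤ 9 / 16 * κ * (3 / 4) :=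
      mul_le_mul h1 (by linarith) (by linarith [Real.add_one_le_exp (1 / 2 : ℝ)]) (by positivity)
    gcongr
    nlinarith
  · by_cases h2 : 47 / 16 * κ ≤ p.real J
    · have hsub : {s | ¬ IsAccurateOn p (empiricalMeasure s) κ J} ⊆
          {s : Fin m → ℝ | -(2 / 3 * (m * κ)) ≤ (-1 / 2) * ∑ i, J.indicator 1 (s i)} := by
        intro s hs
        have h3 : (empiricalMeasure s).real J ≤ 4 / 3 * κ := by
          by_contra! hlt
          exact hs ⟨fun h => absurd h h1, fun _ => hlt⟩
        change -(2 / 3 * (m * κ)) ≤ (-1 / 2) * ∑ i, J.indicator 1 (s i)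
        rw [hsum]
        nlinarith
      refine (measureReal_mono hsub).trans ((measureReal_pi_le_exp p m hJ _ _).trans ?_)
      have he := (abs_le.1 (Real.abs_exp_sub_one_sub_id_le (x := -1 / 2) (by norm_num [abs_le]))).2
      have h3 : p.real J * (Real.exp (-1 / 2) - 1) ≤ -(47 / 64 * κ) := by nlinarith
      gcongr
      nlinarith
    · have hempty : {s : Fin m → ℝ | ¬ IsAccurateOn p (empiricalMeasure s) κ J} = ∅ :=
        eq_empty_of_forall_notMem fun s hs => hs ⟨fun h => absurd h h1, fun h => absurd h h2⟩
      rw [hempty, measureReal_empty]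
      positivity

lemma measureReal_pi_exists_not_isAccurateOn_le (p : Measure ℝ) [IsProbabilityMeasure p] {m : ℕ}
    (hm : m ≠ 0) {κ : ℝ} (hκ : 0 < κ) (N : ℕ) (q : ℕ → ℝ) :
    (Measure.pi fun _ : Fin m => p).real
        {s | ¬ ∀ i ≤ N, ∀ j ≤ N, IsAccurateOn p (empiricalMeasure s) κ (Ico (q i) (q j))} ≤
      ((N : ℝ) + 1) ^ 2 * Real.exp (-(m * κ / 16)) := by
  have hsub : {s | ¬ ∀ i ≤ N, ∀ j ≤ N, IsAccurateOn p (empiricalMeasure s) κ (Ico (q i) (q j))} ⊆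
      ⋃ a ∈ Finset.range (N + 1) ×ˢ Finset.range (N + 1),
        {s : Fin m → ℝ | ¬ IsAccurateOn p (empiricalMeasure s) κ (Ico (q a.1) (q a.2))} := by
    intro s hs
    change ¬ _ at hs
    push Not at hs
    obtain ⟨i, hi, j, hj, hij⟩ := hs
    refine mem_iUnion₂.2 ⟨(i, j), ?_, hij⟩
    simp only [Finset.mem_product, Finset.mem_range]
    omega
  refine (measureReal_mono hsub (measure_ne_top _ _)).trans ((measureReal_biUnion_finset_le _ _).trans ?_)
  refine (Finset.sum_le_card_nsmul _ _ _ fun a _ =>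
    measureReal_pi_not_isAccurateOn_le p hm hκ measurableSet_Ico).trans_eq ?_
  simp [sq]

lemma add_one_sq_mul_exp_le {κ : ℝ} (hκ₀ : 0 < κ) (hκ : κ < 1 / 3) {m : ℕ}
    (hm : 224 * (1 / κ) * Real.log (1 / κ) ≤ m) :
    ((⌈64 / κ⌉₊ : ℝ) + 1) ^ 2 * Real.exp (-(m * κ / 16)) ≤ 1 / 100 := by
  have hN : (⌈64 / κ⌉₊ : ℝ) + 1 ≤ 65 / κ := by
    have h1 := Nat.ceil_lt_add_one (a := 64 / κ) (by positivity)
    have h2 : 2 ≤ 1 / κ := by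
      rw [le_div_iff₀ hκ₀]
      linarith
    have h3 : 65 / κ = 64 / κ + 1 / κ := by ring
    linarith
  have hexp : Real.exp (-(m * κ / 16)) ≤ κ ^ 14 := by
    have h1 : Real.exp (14 * Real.log κ) = κ ^ 14 := by
      rw [show (14 : ℝ) = (14 : ℕ) by norm_num, Real.exp_nat_mul, Real.exp_log hκ₀]
    rw [← h1, Real.exp_le_exp]
    have h2 : 224 * (1 / κ) * Real.log (1 / κ) * κ = -(224 * Real.log κ) := by
      rw [one_div, Real.log_inv]
      field_simp
    nlinarith [mul_le_mul_of_nonneg_right hm hκ₀.le]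
  calc ((⌈64 / κ⌉₊ : ℝ) + 1) ^ 2 * Real.exp (-(m * κ / 16)) ≤ (65 / κ) ^ 2 * κ ^ 14 := by gcongr
    _ = 4225 * κ ^ 12 := by field_simp; norm_num
    _ ≤ 4225 * (1 / 3) ^ 12 := by gcongr
    _ ≤ 1 / 100 := by norm_num

lemma floor_one_div_bounds {κ : ℝ} (hκ₀ : 0 < κ) (hκ : κ < 1 / 3) :
    3 ≤ ⌊1 / κ⌋₊ ∧ κ ≤ 1 / (⌊1 / κ⌋₊ : ℝ) ∧ 1 / (⌊1 / κ⌋₊ : ℝ) ≤ 4 / 3 * κ := by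
  have h3 : 3 ≤ ⌊1 / κ⌋₊ := Nat.le_floor (by
    rw [le_div_iff₀ hκ₀]
    push_cast
    linarith)
  have h3' : (3 : ℝ) ≤ ⌊1 / κ⌋₊ := by exact_mod_cast h3
  have hle := Nat.floor_le (a := 1 / κ) (by positivity)
  have hlt := Nat.lt_floor_add_one (1 / κ)
  rw [le_div_iff₀ hκ₀] at hle
  rw [div_lt_iff₀ hκ₀] at hlt
  refine ⟨h3, ?_, ?_⟩
  · rw [le_div_iff₀ (by linarith)]
    linarith
  · rw [div_le_iff₀ (by linarith)]
    nlinarith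

/-- Lemma lem:part-approx-unif (procedure Approximately-Equal-Partition): using
Õ(1/κ) samples from a κ/64-well-behaved distribution p over [-1,1), one can with
probability ≥ 99/100 produce a partition of [-1,1) into Θ(1/κ) intervals each of
p-mass in [κ/2, 3κ].  The procedure outputs a number ℓ of intervals together with
breakpoints −1 = x₀ ≤ x₁ ≤ ⋯ ≤ x_ℓ = 1. -/
theorem approximately_equal_partition :
    ∃ C c₁ c₂ : ℝ, 0 < C ∧ 0 < c₁ ∧ 0 < c₂ ∧
      ∀ κ : ℝ, 0 < κ → κ < 1 →
      ∀ m : ℕ, m = ⌈C * (1 / κ) * Real.log (1 / κ)⌉₊ →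
        ∃ A : (Fin m → ℝ) → ℕ × (ℕ → ℝ), Measurable A ∧
          ∀ p : Measure ℝ, IsProbabilityMeasure p → p (Set.Ico (-1 : ℝ) 1) = 1 →
            (∀ x : ℝ, p {x} ≤ ENNReal.ofReal (κ / 64)) →
            (99 / 100 : ℝ≥0∞) ≤ (Measure.pi fun _ : Fin m => p)
              {s | c₁ / κ ≤ ((A s).1 : ℝ) ∧ ((A s).1 : ℝ) ≤ c₂ / κ ∧
                   (A s).2 0 = -1 ∧ (A s).2 (A s).1 = 1 ∧
                   MonotoneOn (A s).2 (Set.Iic (A s).1) ∧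
                   ∀ j < (A s).1,
                     ENNReal.ofReal (κ / 2) ≤ p (Set.Ico ((A s).2 j) ((A s).2 (j + 1))) ∧
                     p (Set.Ico ((A s).2 j) ((A s).2 (j + 1))) ≤ ENNReal.ofReal (3 * κ)} := by
  refine ⟨224, 1 / 3, 1, by norm_num, by norm_num, one_pos, fun κ hκ₀ hκ₁ m hm => ?_⟩
  rcases le_or_gt (1 / 3) κ with hκ | hκ
  · refine ⟨fun _ => (1, fun j => if j = 0 then -1 else 1), measurable_const,
      fun p _ hp _ => ?_⟩
    have hall : ∀ S : Set (Fin m → ℝ), (∀ s, s ∈ S) →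
        (99 / 100 : ℝ≥0∞) ≤ (Measure.pi fun _ : Fin m => p) S := fun S hS => by
      rw [eq_univ_of_forall hS, measure_univ]
      exact ENNReal.div_le_of_le_mul (by norm_num)
    refine hall _ fun s => ⟨?_, ?_, by simp, by simp, ?_, ?_⟩
    · rw [div_le_iff₀ hκ₀]
      simpa using hκ
    · rw [le_div_iff₀ hκ₀]
      simpa using hκ₁.le
    · intro i _ j _ hij
      by_cases hi : i = 0 <;> by_cases hj : j = 0 <;> simp [hi, hj]
      omega
    · intro j hj
      obtain rfl : j = 0 := Nat.lt_one_iff.1 hj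
      simp only [if_true, zero_add, one_ne_zero, if_false, hp]
      rw [ENNReal.ofReal_le_one, ENNReal.one_le_ofReal]
      constructor <;> linarith
  have hlog : 0 < Real.log (1 / κ) := Real.log_pos (by rw [lt_div_iff₀ hκ₀]; linarith)
  have hm₀ : m ≠ 0 := by
    rw [hm]
    exact (Nat.ceil_pos.2 (by positivity)).ne'
  have hmle : 224 * (1 / κ) * Real.log (1 / κ) ≤ m := hm ▸ Nat.le_ceil _
  obtain ⟨hl₃, hl₀, hl₁⟩ := floor_one_div_bounds hκ₀ hκ
  have hlfloor := Nat.floor_le (a := 1 / κ) (by positivity)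
  set l := ⌊1 / κ⌋₊
  have hl : l ≠ 0 := by omega
  have hlpos : (0 : ℝ) < l := by exact_mod_cast Nat.pos_of_ne_zero hl
  refine ⟨fun s => (l, quantilePoint (empiricalMeasure s) (-1) 1 l),
    measurable_const.prodMk (measurable_pi_iff.2 fun j =>
      measurable_quantilePoint_empiricalMeasure hm₀ _ _ _ _), fun p _ hp hatom => ?_⟩
  set N := ⌈64 / κ⌉₊
  have hN : N ≠ 0 := (Nat.ceil_pos.2 (by positivity)).ne'
  have hNκ : 1 / (N : ℝ) ≤ κ / 64 := by
    have : 64 / κ ≤ N := Nat.le_ceil _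
    rw [div_le_iff₀ hκ₀] at this
    rw [div_le_iff₀ (by positivity)]
    linarith
  have hatom' : ∀ x, p.real {x} ≤ κ / 64 := fun x =>
    ENNReal.toReal_le_of_le_ofReal (by positivity) (hatom x)
  have hp₂ : p (Ico (-1) 2) = 1 := le_antisymm prob_le_one
    (hp ▸ measure_mono (Ico_subset_Ico_right (by norm_num)))
  set q := quantilePoint p (-1) 2 N
  have hcell : ∀ z ∈ Icc (-1 : ℝ) 1, ∃ i < N, q i ≤ z ∧ z < q (i + 1) ∧
      p.real (Iio (q (i + 1))) - p.real (Iio (q i)) ≤ κ / 32 := fun z hz => by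
    obtain ⟨i, hi, h1, h2, h3⟩ := exists_quantilePoint_cell (by norm_num) hp₂ hatom' hN
      (z := z) ⟨hz.1, by linarith [hz.2]⟩
    exact ⟨i, hi, h1, h2, h3.trans (by linarith)⟩
  set P := Measure.pi fun _ : Fin m => p
  set bad := {s : Fin m → ℝ | ¬ ∀ i ≤ N, ∀ j ≤ N,
    IsAccurateOn p (empiricalMeasure s) κ (Ico (q i) (q j))}
  set out := {s : Fin m → ℝ | ¬ ∀ i, s i ∈ Ico (-1 : ℝ) 1}
  have hbad : P bad ≤ 1 / 100 := by
    have h1 := (measureReal_pi_exists_not_isAccurateOn_le p hm₀ hκ₀ N q).trans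
      (add_one_sq_mul_exp_le hκ₀ hκ hmle)
    refine ((ENNReal.le_ofReal_iff_toReal_le (measure_ne_top _ _) (by norm_num)).2 h1).trans_eq ?_
    rw [ENNReal.ofReal_div_of_pos (by norm_num)]
    norm_num
  have hout : P out = 0 := by
    have h1 : ∀ᵐ x ∂p, x ∈ Ico (-1 : ℝ) 1 := (prob_compl_eq_zero_iff measurableSet_Ico).2 hp
    have h2 : ∀ᵐ s ∂P, ∀ i, s i ∈ Ico (-1 : ℝ) 1 := ae_all_iff.2 fun i =>
      (Measure.quasiMeasurePreserving_eval (fun _ : Fin m => p) i).ae h1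
    exact h2
  have hcover : ∀ S : Set (Fin m → ℝ), (∀ s, s ∉ out → s ∉ bad → s ∈ S) →
      (99 / 100 : ℝ≥0∞) ≤ P S := fun S hS => by
    have h1 : (1 : ℝ≥0∞) ≤ P S + 1 / 100 := by
      calc (1 : ℝ≥0∞) = P univ := measure_univ.symm
        _ ≤ P (S ∪ (out ∪ bad)) := measure_mono fun s _ => by
            by_cases h1 : s ∈ out
            · exact Or.inr (Or.inl h1)
            · by_cases h2 : s ∈ bad
              · exact Or.inr (Or.inr h2)
              · exact Or.inl (hS s h1 h2)
        _ ≤ P S + (P out + P bad) :=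
            (measure_union_le _ _).trans (by gcongr; exact measure_union_le _ _)
        _ ≤ P S + 1 / 100 := by
            rw [hout, zero_add]
            gcongr
    have h2 : (99 / 100 : ℝ≥0∞) + 1 / 100 = 1 := by
      rw [ENNReal.div_add_div_same, show (99 : ℝ≥0∞) + 1 = 100 by norm_num,
        ENNReal.div_self (by norm_num) (by norm_num)]
    refine ENNReal.le_of_add_le_add_right (a := 1 / 100) ?_ (h2.trans_le h1)
    exact ENNReal.div_ne_top (by norm_num) (by norm_num)
  refine hcover _ fun s hs₁ hs₂ => ?_
  have hsmem : ∀ i, s i ∈ Ico (-1 : ℝ) 1 := not_not.1 hs₁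
  have hacc : ∀ i ≤ N, ∀ j ≤ N,
    IsAccurateOn p (empiricalMeasure s) κ (Ico (q i) (q j)) := not_not.1 hs₂
  have := isProbabilityMeasure_empiricalMeasure hm₀ s
  have hν : empiricalMeasure s (Ico (-1) 1) = 1 := by
    have : (empiricalMeasure s).real (Ico (-1) 1) = 1 := by
      rw [empiricalMeasure_real s measurableSet_Ico]
      simp [indicator_of_mem (hsmem _), hm₀]
    rwa [measureReal_def, ENNReal.toReal_eq_one_iff] at this
  have hmono := quantilePoint_monotoneOn (by norm_num) hν l
  have hx₀ : quantilePoint (empiricalMeasure s) (-1) 1 l 0 = -1 := by simp [quantilePoint]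
  have hx₁ : quantilePoint (empiricalMeasure s) (-1) 1 l l = 1 := by simp [quantilePoint, hl]
  have hrange : ∀ j ≤ l, quantilePoint (empiricalMeasure s) (-1) 1 l j ∈ Icc (-1 : ℝ) 1 :=
    fun j hj => ⟨hx₀.ge.trans (hmono (Nat.zero_le l) hj (Nat.zero_le j)),
      (hmono hj (le_refl l) hj).trans hx₁.le⟩
  refine ⟨?_, hlfloor, hx₀, hx₁, hmono, fun j hj => ?_⟩
  · rw [div_le_iff₀ (by positivity)] at hl₁ ⊢
    linarith
  · have hstep : ((j + 1 : ℕ) : ℝ) / l - j / l = 1 / l := by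
      push_cast
      ring
    have hmass := measureReal_Ico_mem_Icc hκ₀ hacc (hcell _ (hrange j hj.le))
      (hcell _ (hrange (j + 1) hj)) (hmono hj.le hj j.le_succ)
      (isQuantile_quantilePoint (by norm_num) hν hl hj.le)
      (isQuantile_quantilePoint (by norm_num) hν hl hj) (hstep ▸ hl₀) (hstep ▸ hl₁)
    exact ⟨ENNReal.ofReal_le_of_le_toReal hmass.1,
      (ENNReal.le_ofReal_iff_toReal_le (measure_ne_top _ _) (by positivity)).2 hmass.2⟩
end
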